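/- arXiv:1608.00875 — 3 statements merged into one kernel-verified Lean document; each statement's English description precedes it below -/
import Mathlib

section
/- Set w̄_i = w_i − (N−1)t. For every integer n ≥ 1 and every polynomial f in one variable with coefficients in k₀, the commutator of the multiplication operator by Σ_{i=1}^N B̄_n(w̄_i) with F_1[f] satisfies [Σ_{i=1}^N B̄_n(w̄_i), F_1[f]] = ħ · F_1[g], where g is the one-variable polynomial g(v) = f(v) · (v − (N−1)t + ħ)^{n−1}. -/
/-!
Setup: `k0 l` is the field k₀ = ℂ(ħ, t, z₁, …, z_l) and `KK l N` is the field
K = ℂ(ħ, t, z₁, …, z_l, w₁, …, w_N), realized as the rational function field in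
w₁, …, w_N over k₀.  Operators are k₀-linear endomorphisms of K, products of
operators denote composition, and `[A, B] = A * B - B * A`.
-/

open MvPolynomial Finset

set_option synthInstance.maxHeartbeats 1000000
set_option maxHeartbeats 2000000

noncomputable section

/-- The coefficient field k₀ = ℂ(ħ, t, z₁, …, z_l). -/
def k0 (l : ℕ) : Type := FractionRing (MvPolynomial (Fin 2 ⊕ Fin l) ℂ)

instance (l : ℕ) : Field (k0 l) := inferInstanceAs (Field (FractionRing _))
instance (l : ℕ) : Algebra (MvPolynomial (Fin 2 ⊕ Fin l) ℂ) (k0 l) :=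
  inferInstanceAs (Algebra _ (FractionRing _))
instance (l : ℕ) : IsFractionRing (MvPolynomial (Fin 2 ⊕ Fin l) ℂ) (k0 l) :=
  inferInstanceAs (IsFractionRing _ (FractionRing _))
instance (l : ℕ) : CharZero (k0 l) :=
  charZero_of_injective_algebraMap
    (IsFractionRing.injective (MvPolynomial (Fin 2 ⊕ Fin l) ℂ) (k0 l))

/-- The field K = ℂ(ħ, t, z₁, …, z_l, w₁, …, w_N), as k₀(w₁, …, w_N). -/
def KK (l N : ℕ) : Type := FractionRing (MvPolynomial (Fin N) (k0 l))

instance (l N : ℕ) : Field (KK l N) := inferInstanceAs (Field (FractionRing _))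
instance (l N : ℕ) : Algebra (MvPolynomial (Fin N) (k0 l)) (KK l N) :=
  inferInstanceAs (Algebra _ (FractionRing _))
instance (l N : ℕ) : IsFractionRing (MvPolynomial (Fin N) (k0 l)) (KK l N) :=
  inferInstanceAs (IsFractionRing _ (FractionRing _))
instance (l N : ℕ) : Algebra (k0 l) (KK l N) :=
  inferInstanceAs (Algebra _ (FractionRing (MvPolynomial (Fin N) (k0 l))))
instance (l N : ℕ) : IsScalarTower (k0 l) (MvPolynomial (Fin N) (k0 l)) (KK l N) :=
  inferInstanceAs (IsScalarTower _ _ (FractionRing _))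
instance (l N : ℕ) : CharZero (KK l N) :=
  charZero_of_injective_algebraMap
    (IsFractionRing.injective (MvPolynomial (Fin N) (k0 l)) (KK l N))

variable (l N : ℕ)

/-- ħ as an element of k₀. -/
def hb0 : k0 l := algebraMap (MvPolynomial (Fin 2 ⊕ Fin l) ℂ) (k0 l) (X (Sum.inl 0))
/-- t as an element of k₀. -/
def tt0 : k0 l := algebraMap (MvPolynomial (Fin 2 ⊕ Fin l) ℂ) (k0 l) (X (Sum.inl 1))
/-- z_k as an element of k₀. -/
def zz0 (k : Fin l) : k0 l := algebraMap (MvPolynomial (Fin 2 ⊕ Fin l) ℂ) (k0 l) (X (Sum.inr k))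

/-- ħ as an element of K. -/
def hbar : KK l N := algebraMap (k0 l) (KK l N) (hb0 l)
/-- t as an element of K. -/
def tt : KK l N := algebraMap (k0 l) (KK l N) (tt0 l)
/-- z_k as an element of K. -/
def zz (k : Fin l) : KK l N := algebraMap (k0 l) (KK l N) (zz0 l k)
/-- w_i as an element of K. -/
def ww (i : Fin N) : KK l N := algebraMap (MvPolynomial (Fin N) (k0 l)) (KK l N) (X i)

/-- The ring of k₀-linear endomorphisms of K; multiplication is composition. -/
abbrev Op (l N : ℕ) := Module.End (k0 l) (KK l N)

/-- The multiplication operator by an element of K. -/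
def mulOp (a : KK l N) : Op l N := LinearMap.mulLeft (k0 l) a

/-- The normalized Bernoulli polynomial B̄_n(w) = (−ħ)^n B_n(−w/ħ)/n evaluated at v ∈ K. -/
def Bbar (n : ℕ) (v : KK l N) : KK l N :=
  ((-(hbar l N)) ^ n *
    Polynomial.aeval (-v / hbar l N) ((Polynomial.bernoulli n).map (algebraMap ℚ (KK l N)))) /
    (n : KK l N)

/-- w̄_i = w_i − (N−1)t. -/
def wbar (i : Fin N) : KK l N := ww l N i - ((N - 1 : ℕ) : KK l N) * tt l N

variable (u : Fin N → (KK l N ≃ₐ[k0 l] KK l N))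

/-- The operator F₁[f] for a one-variable polynomial f with coefficients in k₀. -/
def F1op (f : Polynomial (k0 l)) : Op l N :=
  ∑ i : Fin N,
    mulOp l N
      (Polynomial.aeval (ww l N i - hbar l N) f *
        (∏ j ∈ ({i}ᶜ : Finset (Fin N)), (ww l N i - ww l N j + tt l N) / (ww l N i - ww l N j)) *
        ∏ k : Fin l, (ww l N i - hbar l N - zz l N k)) *
      (u i).symm.toLinearMap

theorem Polynomial.aeval_bernoulli_add_one {A : Type*} [CommRing A] [Algebra ℚ A] (n : ℕ) (x : A) :
    Polynomial.aeval (x + 1) (Polynomial.bernoulli n) =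
      Polynomial.aeval x (Polynomial.bernoulli n) + n * x ^ (n - 1) := by
  have h : (Polynomial.bernoulli n).comp (Polynomial.X + 1) =
      Polynomial.bernoulli n + (n : Polynomial ℚ) * Polynomial.X ^ (n - 1) := by
    refine Polynomial.funext fun r => ?_
    simpa [add_comm] using Polynomial.bernoulli_eval_one_add n r
  simpa [Polynomial.aeval_comp] using congrArg (Polynomial.aeval x) h

theorem hbar_ne_zero : hbar l N ≠ 0 := by
  have h0 : hb0 l ≠ 0 := by
    simp [hb0]
  simpa [hbar] using h0

theorem Bbar_eq_aeval (n : ℕ) (v : KK l N) :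
    Bbar l N n v = ((-(hbar l N)) ^ n *
      Polynomial.aeval (-v / hbar l N) (Polynomial.bernoulli n)) / (n : KK l N) := by
  rw [Bbar, Polynomial.aeval_map_algebraMap]

/-- The difference equation of the normalized Bernoulli polynomials. -/
theorem Bbar_sub_Bbar_sub_hbar {n : ℕ} (hn : 1 ≤ n) (v : KK l N) :
    Bbar l N n v - Bbar l N n (v - hbar l N) = hbar l N * v ^ (n - 1) := by
  have hh := hbar_ne_zero l N
  obtain ⟨m, rfl⟩ : ∃ m, n = m + 1 := ⟨n - 1, by omega⟩
  have hn0 : ((m + 1 : ℕ) : KK l N) ≠ 0 := Nat.cast_ne_zero.mpr m.succ_ne_zero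
  have hshift : -(v - hbar l N) / hbar l N = -v / hbar l N + 1 := by field_simp; ring
  have hpow : (-(hbar l N)) ^ m * (-v / hbar l N) ^ m = v ^ m := by
    rw [← mul_pow]; congr 1; field_simp
  rw [Bbar_eq_aeval, Bbar_eq_aeval, hshift, Polynomial.aeval_bernoulli_add_one, ← sub_div,
    div_eq_iff hn0, Nat.add_sub_cancel, ← hpow]
  ring

theorem map_Bbar (e : KK l N ≃ₐ[k0 l] KK l N) (n : ℕ) (v : KK l N) :
    e (Bbar l N n v) = Bbar l N n (e v) := by
  have hh : e (hbar l N) = hbar l N := e.commutes _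
  have ha (x : KK l N) : e (Polynomial.aeval x (Polynomial.bernoulli n)) =
      Polynomial.aeval (e x) (Polynomial.bernoulli n) :=
    (Polynomial.aeval_algHom_apply (e : KK l N →+* KK l N).toRatAlgHom x _).symm
  simp only [Bbar_eq_aeval, map_div₀, map_mul, map_pow, map_neg, map_natCast, hh, ha]

theorem symm_wbar
    (hu : ∀ i j, u i (ww l N j) = ww l N j + if j = i then hbar l N else 0) (i j : Fin N) :
    (u i).symm (wbar l N j) = wbar l N j - if j = i then hbar l N else 0 := by
  have hh : u i (hbar l N) = hbar l N := (u i).commutes _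
  have ht : u i (tt l N) = tt l N := (u i).commutes _
  rw [AlgEquiv.symm_apply_eq]
  simp only [wbar, map_sub, map_mul, map_natCast, ht, hu, apply_ite (u i), hh, map_zero]
  ring

theorem sum_Bbar_sub_symm
    (hu : ∀ i j, u i (ww l N j) = ww l N j + if j = i then hbar l N else 0)
    {n : ℕ} (hn : 1 ≤ n) (i : Fin N) :
    (∑ j, Bbar l N n (wbar l N j)) - (u i).symm (∑ j, Bbar l N n (wbar l N j)) =
      hbar l N * wbar l N i ^ (n - 1) := by
  simp only [map_sum, map_Bbar, symm_wbar l N u hu]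
  rw [← Finset.sum_sub_distrib, Finset.sum_eq_single i]
  · simpa using Bbar_sub_Bbar_sub_hbar l N hn (wbar l N i)
  · intro j _ hj
    simp [hj]
  · simp

theorem aeval_sub_hbar_shift (i : Fin N) :
    Polynomial.aeval (ww l N i - hbar l N) (Polynomial.X +
      Polynomial.C (hb0 l - ((N - 1 : ℕ) : k0 l) * tt0 l)) = wbar l N i := by
  simp only [map_add, Polynomial.aeval_X, Polynomial.aeval_C, map_sub, map_mul, map_natCast,
    wbar, hbar, tt]
  ring

theorem statement3 (hN : 1 ≤ N)
    (hu : ∀ i j, u i (ww l N j) = ww l N j + if j = i then hbar l N else 0)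
    (n : ℕ) (hn : 1 ≤ n) (f : Polynomial (k0 l)) :
    mulOp l N (∑ i : Fin N, Bbar l N n (wbar l N i)) * F1op l N u f
      - F1op l N u f * mulOp l N (∑ i : Fin N, Bbar l N n (wbar l N i))
      = mulOp l N (hbar l N) *
          F1op l N u (f * (Polynomial.X +
            Polynomial.C (hb0 l - ((N - 1 : ℕ) : k0 l) * tt0 l)) ^ (n - 1)) := by
  refine LinearMap.ext fun x => ?_
  simp only [F1op, mulOp, LinearMap.sub_apply, Module.End.mul_apply, LinearMap.sum_apply,
    LinearMap.mulLeft_apply, AlgEquiv.toLinearMap_apply, Finset.mul_sum (s := Finset.univ),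
    ← Finset.sum_sub_distrib]
  refine Finset.sum_congr rfl fun i _ => ?_
  have hS := sum_Bbar_sub_symm l N u hu hn i
  simp only [map_mul, map_pow, aeval_sub_hbar_shift]
  linear_combination (Polynomial.aeval (ww l N i - hbar l N) f *
    (∏ j ∈ ({i}ᶜ : Finset (Fin N)), (ww l N i - ww l N j + tt l N) / (ww l N i - ww l N j)) *
    (∏ k : Fin l, (ww l N i - hbar l N - zz l N k)) * (u i).symm x) * hS
end
end

section
/- For all 1 ≤ i < j ≤ N, the trigonometric Dunkl operators and the permutation operators satisfy σ_{ij} ∘ (D_i + t Σ_{k>i} σ_{ik}) = (D_j + t Σ_{k>j} σ_{jk}) ∘ σ_{ij} as linear endomorphisms of F. -/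
/-!
Setup: `k0 l` is the field k₀ = ℂ(ħ, t, z₁, …, z_l) and `KK l N` is the field
K = ℂ(ħ, t, z₁, …, z_l, w₁, …, w_N), realized as the rational function field in
w₁, …, w_N over k₀.  Operators are k₀-linear endomorphisms of K, products of
operators denote composition, and `[A, B] = A * B - B * A`.
-/

open MvPolynomial Finset

set_option synthInstance.maxHeartbeats 1000000
set_option maxHeartbeats 2000000

noncomputable section

variable (l N : ℕ)

/- Here we write X_i for the generator `ww l N i` of F = ℂ(ħ, t, z₁, …, z_l)(X₁, …, X_N),
`σ i k` (for i ≠ k) is the field automorphism exchanging X_i and X_k and fixing the other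
generators, and `pd i` is the partial derivative ∂_i (a k₀-linear derivation with
∂_i X_j = δ_{ij}), both taken as parameters characterized by hypotheses in the theorem. -/

variable (σ : Fin N → Fin N → (KK l N ≃ₐ[k0 l] KK l N))
variable (pd : Fin N → Module.End (k0 l) (KK l N))

/-- σ_{ik} as a k₀-linear endomorphism. -/
def sL (i k : Fin N) : Op l N := (σ i k).toLinearMap

/-- The trigonometric Dunkl operator
D_i = −ħ X_i ∂_i + t Σ_{k≠i} (X_i/(X_i − X_k))(1 − σ_{ik}) + t Σ_{k<i} σ_{ik}. -/
def Dop (i : Fin N) : Op l N :=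
  -(mulOp l N (hbar l N * ww l N i) * pd i)
  + ∑ k ∈ ({i}ᶜ : Finset (Fin N)),
      mulOp l N (tt l N * (ww l N i / (ww l N i - ww l N k))) * (1 - sL l N σ i k)
  + ∑ k ∈ Finset.Iio i, mulOp l N (tt l N) * sL l N σ i k

variable {l N}

/-- A `k₀`-algebra endomorphism of `K` is determined by its values on the generators. -/
theorem algHom_ext_ww {f g : KK l N →ₐ[k0 l] KK l N}
    (h : ∀ m, f (ww l N m) = g (ww l N m)) : f = g := by
  refine IsLocalization.algHom_ext (nonZeroDivisors (MvPolynomial (Fin N) (k0 l))) ?_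
  exact MvPolynomial.algHom_ext h

/-- A twisted derivation of `K` over an injective endomorphism is determined by its values on the
generators. -/
theorem twistedDerivation_ext_ww (φ : KK l N →ₐ[k0 l] KK l N) {A B : Op l N}
    (hA : ∀ a b, A (a * b) = φ a * A b + A a * φ b)
    (hB : ∀ a b, B (a * b) = φ a * B b + B a * φ b)
    (h : ∀ m, A (ww l N m) = B (ww l N m)) : A = B := by
  have one_eq_zero {C : Op l N} (hC : ∀ a b, C (a * b) = φ a * C b + C a * φ b) : C 1 = 0 := by
    simpa using hC 1 1
  have hpoly (p : MvPolynomial (Fin N) (k0 l)) :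
      A (algebraMap _ (KK l N) p) = B (algebraMap _ (KK l N) p) := by
    induction p using MvPolynomial.induction_on with
    | C c =>
      rw [← MvPolynomial.algebraMap_eq, ← IsScalarTower.algebraMap_apply,
        Algebra.algebraMap_eq_smul_one, map_smul, map_smul, one_eq_zero hA, one_eq_zero hB]
    | add p q hp hq => rw [map_add, map_add, map_add, hp, hq]
    | mul_X p m hp =>
      rw [map_mul, hA, hB, hp, show A (algebraMap _ (KK l N) (X m)) = _ from h m]
      rfl
  refine LinearMap.ext fun x => ?_
  obtain ⟨p, q, hq, rfl⟩ := IsFractionRing.div_surjective (A := MvPolynomial (Fin N) (k0 l)) x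
  have hq0 : algebraMap _ (KK l N) q ≠ 0 :=
    IsFractionRing.to_map_ne_zero_of_mem_nonZeroDivisors hq
  have hp := hpoly p
  rw [← div_mul_cancel₀ (algebraMap _ (KK l N) p) hq0, hA, hB, hpoly q] at hp
  exact mul_right_cancel₀ ((map_ne_zero φ).2 hq0) (add_left_cancel hp)

/-- An automorphism of `K` conjugates multiplication by `a` to multiplication by its image. -/
theorem toLinearMap_mul_mulOp (φ : KK l N ≃ₐ[k0 l] KK l N) (a : KK l N) :
    (φ.toLinearMap : Op l N) * mulOp l N a = mulOp l N (φ a) * (φ.toLinearMap : Op l N) :=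
  LinearMap.ext fun x => map_mul φ a x

/-- The sum of `D_i` and `t Σ_{k>i} σ_{ik}`, with both sums running over all `k ≠ i`. -/
theorem Dop_add_sum_Ioi (σ : Fin N → Fin N → (KK l N ≃ₐ[k0 l] KK l N))
    (pd : Fin N → Op l N) (i : Fin N) :
    Dop l N σ pd i + mulOp l N (tt l N) * ∑ k ∈ Finset.Ioi i, sL l N σ i k =
      -(mulOp l N (hbar l N * ww l N i) * pd i) +
        ∑ k ∈ ({i}ᶜ : Finset (Fin N)),
          (mulOp l N (tt l N * (ww l N i / (ww l N i - ww l N k))) * (1 - sL l N σ i k) +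
            mulOp l N (tt l N) * sL l N σ i k) := by
  have hunion : ({i}ᶜ : Finset (Fin N)) = Finset.Iio i ∪ Finset.Ioi i := by
    ext k
    simp [lt_or_lt_iff_ne]
  have hdisj : Disjoint (Finset.Iio i) (Finset.Ioi i) :=
    Finset.disjoint_left.2 fun k hk hk' =>
      lt_asymm (Finset.mem_Iio.1 hk) (Finset.mem_Ioi.1 hk')
  have hsum : ∑ k ∈ ({i}ᶜ : Finset (Fin N)), sL l N σ i k =
      ∑ k ∈ Finset.Iio i, sL l N σ i k + ∑ k ∈ Finset.Ioi i, sL l N σ i k := by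
    rw [hunion, Finset.sum_union hdisj]
  rw [Finset.sum_add_distrib, ← Finset.mul_sum {i}ᶜ (fun k => sL l N σ i k), Dop,
    ← Finset.mul_sum (Finset.Iio i) (fun k => sL l N σ i k), hsum, mul_add, ← add_assoc,
    ← add_assoc]

variable (l N)

theorem statement16 (hN : 1 ≤ N)
    (hσ : ∀ i k, i ≠ k →
      (σ i k) (ww l N i) = ww l N k ∧ (σ i k) (ww l N k) = ww l N i ∧
        ∀ j, j ≠ i → j ≠ k → (σ i k) (ww l N j) = ww l N j)
    (hLeib : ∀ i (a b : KK l N), pd i (a * b) = a * pd i b + pd i a * b)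
    (hX : ∀ i j, pd i (ww l N j) = if j = i then 1 else 0)
    (i j : Fin N) (hij : i < j) :
    sL l N σ i j *
        (Dop l N σ pd i + mulOp l N (tt l N) * ∑ k ∈ Finset.Ioi i, sL l N σ i k)
      = (Dop l N σ pd j + mulOp l N (tt l N) * ∑ k ∈ Finset.Ioi j, sL l N σ j k) *
          sL l N σ i j := by
  have hσw (a b : Fin N) (hab : a ≠ b) (m : Fin N) :
      σ a b (ww l N m) = ww l N (Equiv.swap a b m) := by
    obtain ⟨h1, h2, h3⟩ := hσ a b hab
    rcases eq_or_ne m a with rfl | hma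
    · rw [Equiv.swap_apply_left, h1]
    rcases eq_or_ne m b with rfl | hmb
    · rw [Equiv.swap_apply_right, h2]
    · rw [Equiv.swap_apply_of_ne_of_ne hma hmb, h3 m hma hmb]
  have hne : i ≠ j := hij.ne
  have hconj (k : Fin N) (hk : k ≠ i) :
      sL l N σ i j * sL l N σ i k = sL l N σ j (Equiv.swap i j k) * sL l N σ i j := by
    have hk' : j ≠ Equiv.swap i j k := fun h =>
      hk ((Equiv.swap i j).injective (by rw [← h, Equiv.swap_apply_left]))
    have hext : (σ i j : KK l N →ₐ[k0 l] KK l N).comp (σ i k : KK l N →ₐ[k0 l] KK l N) =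
        (σ j (Equiv.swap i j k) : KK l N →ₐ[k0 l] KK l N).comp
          (σ i j : KK l N →ₐ[k0 l] KK l N) := by
      refine algHom_ext_ww fun m => ?_
      have hswap := Equiv.swap_apply_apply (Equiv.swap i j) i k
      rw [Equiv.swap_apply_left] at hswap
      change σ i j (σ i k (ww l N m)) = σ j (Equiv.swap i j k) (σ i j (ww l N m))
      rw [hσw i k hk.symm, hσw i j hne, hσw i j hne, hσw j _ hk', hswap]
      simp
    exact congrArg AlgHom.toLinearMap hext
  have htt : σ i j (tt l N) = tt l N := (σ i j).commutes _
  have hhbar : σ i j (hbar l N) = hbar l N := (σ i j).commutes _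
  have hwi : σ i j (ww l N i) = ww l N j := (hσ i j hne).1
  have hmul (a : KK l N) : sL l N σ i j * mulOp l N a = mulOp l N (σ i j a) * sL l N σ i j :=
    toLinearMap_mul_mulOp (σ i j) a
  have hpd : sL l N σ i j * pd i = pd j * sL l N σ i j := by
    refine twistedDerivation_ext_ww (σ i j : KK l N →ₐ[k0 l] KK l N) (fun a b => ?_)
      (fun a b => ?_) fun m => ?_
    · change σ i j (pd i (a * b)) = σ i j a * σ i j (pd i b) + σ i j (pd i a) * σ i j b
      rw [hLeib, map_add, map_mul, map_mul]
    · change pd j (σ i j (a * b)) = σ i j a * pd j (σ i j b) + pd j (σ i j a) * σ i j b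
      rw [map_mul, hLeib]
    · change σ i j (pd i (ww l N m)) = pd j (σ i j (ww l N m))
      rw [hX, hσw i j hne, hX, apply_ite (σ i j), map_one, map_zero]
      simp only [Equiv.swap_apply_eq_iff, Equiv.swap_apply_right]
  rw [Dop_add_sum_Ioi, Dop_add_sum_Ioi, mul_add, add_mul,
    show ∀ A B : Op l N, A * -B = -(A * B) from
      fun A B => LinearMap.ext fun x => map_neg A (B x),
    show ∀ A B : Op l N, -A * B = -(A * B) from fun _ _ => rfl, ← mul_assoc, hmul,
    mul_assoc, hpd, ← mul_assoc, map_mul, hhbar, hwi, Finset.mul_sum, Finset.sum_mul]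
  congr 1
  refine Finset.sum_equiv (Equiv.swap i j) (fun k => ?_) fun k hk => ?_
  · simp [Equiv.swap_apply_eq_iff]
  · have hki : k ≠ i := by simpa using hk
    rw [mul_add, add_mul, ← mul_assoc, hmul, mul_assoc, mul_sub, hconj k hki, ← mul_assoc, hmul,
      mul_assoc, hconj k hki, map_mul, map_div₀, map_sub, htt, hwi, hσw i j hne k, mul_one,
      mul_assoc, mul_assoc, sub_mul, one_mul]
end
end

section
/- For every chain of indices 1 ≤ i_0 < i_1 < ⋯ < i_p ≤ N, the trigonometric Dunkl operators and the permutation operators satisfy σ_{i_{p−1} i_p} ∘ σ_{i_{p−2} i_{p−1}} ∘ ⋯ ∘ σ_{i_1 i_2} ∘ σ_{i_0 i_1} ∘ (D_{i_0} + t Σ_{k > i_0} σ_{i_0 k}) = (D_{i_p} + t Σ_{k > i_p} σ_{i_p k}) ∘ σ_{i_{p−1} i_p} ∘ σ_{i_{p−2} i_{p−1}} ∘ ⋯ ∘ σ_{i_1 i_2} ∘ σ_{i_0 i_1} as linear endomorphisms of F. -/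
/-!
Setup: `k0 l` is the field k₀ = ℂ(ħ, t, z₁, …, z_l) and `KK l N` is the field
K = ℂ(ħ, t, z₁, …, z_l, w₁, …, w_N), realized as the rational function field in
w₁, …, w_N over k₀.  Operators are k₀-linear endomorphisms of K, products of
operators denote composition, and `[A, B] = A * B - B * A`.
-/

open MvPolynomial Finset

set_option synthInstance.maxHeartbeats 1000000
set_option maxHeartbeats 2000000

noncomputable section

variable (l N : ℕ)

/- Here we write X_i for the generator `ww l N i` of F = ℂ(ħ, t, z₁, …, z_l)(X₁, …, X_N),
`σ i k` (for i ≠ k) is the field automorphism exchanging X_i and X_k and fixing the other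
generators, and `pd i` is the partial derivative ∂_i (a k₀-linear derivation with
∂_i X_j = δ_{ij}), both taken as parameters characterized by hypotheses in the theorem. -/

variable (σ : Fin N → Fin N → (KK l N ≃ₐ[k0 l] KK l N))
variable (pd : Fin N → Module.End (k0 l) (KK l N))

/-- The composition σ_{i_{p−1} i_p} ∘ σ_{i_{p−2} i_{p−1}} ∘ ⋯ ∘ σ_{i_1 i_2} ∘ σ_{i_0 i_1}
for a chain i_0 < i_1 < ⋯ < i_p given by a strictly monotone map c : Fin (p+1) → Fin N. -/
def chainOp (p : ℕ) (c : Fin (p + 1) → Fin N) : Op l N :=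
  ((List.ofFn (fun m : Fin p => sL l N σ (c m.castSucc) (c m.succ))).reverse).prod

/-- Algebra endomorphisms of `KK l N` agree as soon as they agree on the generators. -/
theorem KK.algHom_ext {f g : KK l N →ₐ[k0 l] KK l N}
    (h : ∀ j, f (ww l N j) = g (ww l N j)) : f = g := by
  have hP : f.comp (IsScalarTower.toAlgHom (k0 l) (MvPolynomial (Fin N) (k0 l)) (KK l N)) =
      g.comp (IsScalarTower.toAlgHom (k0 l) (MvPolynomial (Fin N) (k0 l)) (KK l N)) :=
    MvPolynomial.algHom_ext h
  ext x
  obtain ⟨a, b, -, rfl⟩ := IsFractionRing.div_surjective (A := MvPolynomial (Fin N) (k0 l)) x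
  rw [map_div₀, map_div₀]
  exact congrArg₂ (· / ·) (DFunLike.congr_fun hP a) (DFunLike.congr_fun hP b)

/-- Derivations of `KK l N` agree as soon as they agree on the generators. -/
theorem KK.derivation_ext {D E : Derivation (k0 l) (KK l N) (KK l N)}
    (h : ∀ j, D (ww l N j) = E (ww l N j)) : D = E := by
  have hP : D.compAlgebraMap (MvPolynomial (Fin N) (k0 l)) =
      E.compAlgebraMap (MvPolynomial (Fin N) (k0 l)) :=
    MvPolynomial.derivation_ext h
  have hP' (a : MvPolynomial (Fin N) (k0 l)) :
      D (algebraMap _ (KK l N) a) = E (algebraMap _ (KK l N) a) := DFunLike.congr_fun hP a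
  ext x
  obtain ⟨a, b, -, rfl⟩ := IsFractionRing.div_surjective (A := MvPolynomial (Fin N) (k0 l)) x
  rw [Derivation.leibniz_div, Derivation.leibniz_div, hP', hP']

/-- `σ i k` exchanges the generators `w_i` and `w_k` and fixes the others. -/
def IsExchange : Prop :=
  ∀ i k, i ≠ k →
    (σ i k) (ww l N i) = ww l N k ∧ (σ i k) (ww l N k) = ww l N i ∧
      ∀ j, j ≠ i → j ≠ k → (σ i k) (ww l N j) = ww l N j

variable {l N σ pd}

theorem IsExchange.apply_ww (hσ : IsExchange l N σ) {i j : Fin N} (hij : i ≠ j) (k : Fin N) :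
    σ i j (ww l N k) = ww l N (Equiv.swap i j k) := by
  obtain ⟨h1, h2, h3⟩ := hσ i j hij
  rcases eq_or_ne k i with rfl | hki
  · rw [h1, Equiv.swap_apply_left]
  rcases eq_or_ne k j with rfl | hkj
  · rw [h2, Equiv.swap_apply_right]
  rw [h3 k hki hkj, Equiv.swap_apply_of_ne_of_ne hki hkj]

theorem IsExchange.apply_apply (hσ : IsExchange l N σ) {i j a b : Fin N} (hij : i ≠ j)
    (hab : a ≠ b) (x : KK l N) :
    σ i j (σ a b x) = σ (Equiv.swap i j a) (Equiv.swap i j b) (σ i j x) := by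
  have hne : Equiv.swap i j a ≠ Equiv.swap i j b := (Equiv.swap i j).injective.ne hab
  have h : ((σ i j).toAlgHom.comp (σ a b).toAlgHom) =
      (σ (Equiv.swap i j a) (Equiv.swap i j b)).toAlgHom.comp (σ i j).toAlgHom := by
    refine KK.algHom_ext l N fun k => ?_
    change σ i j (σ a b _) = σ _ _ (σ i j _)
    rw [hσ.apply_ww hab, hσ.apply_ww hij, hσ.apply_ww hij, hσ.apply_ww hne,
      Equiv.swap_apply_apply]
    simp
  exact DFunLike.congr_fun h x

theorem IsExchange.apply_pd (hσ : IsExchange l N σ)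
    (hLeib : ∀ i (a b : KK l N), pd i (a * b) = a * pd i b + pd i a * b)
    (hX : ∀ i j, pd i (ww l N j) = if j = i then 1 else 0)
    {i j : Fin N} (hij : i ≠ j) (x : KK l N) :
    σ i j (pd i x) = pd j (σ i j x) := by
  let D : Derivation (k0 l) (KK l N) (KK l N) := Derivation.mk' (pd i) fun a b => by
    rw [hLeib, smul_eq_mul, smul_eq_mul, mul_comm b]
  let E : Derivation (k0 l) (KK l N) (KK l N) :=
    Derivation.mk' ((σ i j).symm.toLinearMap ∘ₗ pd j ∘ₗ (σ i j).toLinearMap) fun a b => by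
      simp [hLeib, mul_comm b]
  have h : D = E := KK.derivation_ext l N fun k => by
    change pd i (ww l N k) = (σ i j).symm (pd j (σ i j (ww l N k)))
    have hk : Equiv.swap i j k = j ↔ k = i := by
      rw [Equiv.swap_apply_eq_iff, Equiv.swap_apply_right]
    rw [hσ.apply_ww hij, hX, hX]
    simp only [hk]
    split_ifs <;> simp
  have hx : pd i x = (σ i j).symm (pd j (σ i j x)) := DFunLike.congr_fun h x
  rw [hx, AlgEquiv.apply_symm_apply]

variable (l N σ pd)

/-- The symmetrized Dunkl operator `D_i + t Σ_{k > i} σ_{ik}`. -/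
def symDop (i : Fin N) : Op l N :=
  Dop l N σ pd i + mulOp l N (tt l N) * ∑ k ∈ Finset.Ioi i, sL l N σ i k

theorem symDop_apply (i : Fin N) (x : KK l N) :
    symDop l N σ pd i x = -(hbar l N * ww l N i * pd i x) +
      ∑ k ∈ ({i}ᶜ : Finset (Fin N)),
        (tt l N * (ww l N i / (ww l N i - ww l N k)) * (x - σ i k x) + tt l N * σ i k x) := by
  have hsplit : ({i}ᶜ : Finset (Fin N)) = (Finset.Iio i).disjUnion (Finset.Ioi i)
      (Finset.disjoint_left.2 fun k h1 h2 =>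
        lt_asymm (Finset.mem_Iio.1 h1) (Finset.mem_Ioi.1 h2)) := by
    ext k
    simp
  have hsum : ∑ k ∈ ({i}ᶜ : Finset (Fin N)), tt l N * σ i k x =
      ∑ k ∈ Finset.Iio i, tt l N * σ i k x + ∑ k ∈ Finset.Ioi i, tt l N * σ i k x := by
    rw [hsplit, Finset.sum_disjUnion]
  rw [Finset.sum_add_distrib, hsum]
  simp only [symDop, Dop, mulOp, sL, LinearMap.add_apply, LinearMap.neg_apply, Module.End.mul_apply,
    LinearMap.sum_apply, LinearMap.mulLeft_apply, LinearMap.sub_apply, Module.End.one_apply,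
    AlgEquiv.toLinearMap_apply, Finset.mul_sum]
  ring

theorem chainOp_succ (p : ℕ) (c : Fin (p + 2) → Fin N) :
    chainOp l N σ (p + 1) c =
      sL l N σ (c (Fin.last p).castSucc) (c (Fin.last (p + 1))) *
        chainOp l N σ p (c ∘ Fin.castSucc) := by
  simp only [chainOp, List.ofFn_succ', List.concat_eq_append, List.reverse_append,
    List.reverse_singleton, List.singleton_append, List.prod_cons, Fin.succ_last,
    Function.comp_apply, Fin.succ_castSucc]

variable {l N σ pd}

theorem semiconjBy_symDop (hσ : IsExchange l N σ)
    (hLeib : ∀ i (a b : KK l N), pd i (a * b) = a * pd i b + pd i a * b)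
    (hX : ∀ i j, pd i (ww l N j) = if j = i then 1 else 0)
    {i j : Fin N} (hij : i ≠ j) :
    SemiconjBy (sL l N σ i j) (symDop l N σ pd i) (symDop l N σ pd j) := by
  refine LinearMap.ext fun x => ?_
  change σ i j (symDop l N σ pd i x) = symDop l N σ pd j (σ i j x)
  have hh : σ i j (hbar l N) = hbar l N := (σ i j).commutes _
  have ht : σ i j (tt l N) = tt l N := (σ i j).commutes _
  rw [symDop_apply, symDop_apply, map_add, map_neg, map_mul, map_mul, hh, hσ.apply_ww hij,
    hσ.apply_pd hLeib hX hij, Equiv.swap_apply_left, map_sum]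
  congr 1
  refine Finset.sum_equiv (Equiv.swap i j) (fun k => ?_) fun k hk => ?_
  · rw [Finset.mem_compl, Finset.mem_compl, Finset.mem_singleton, Finset.mem_singleton,
      Equiv.swap_apply_eq_iff, Equiv.swap_apply_right]
  · have hik : i ≠ k := fun h => by simp [h] at hk
    simp only [map_add, map_mul, map_div₀, map_sub, ht, hσ.apply_ww hij,
      hσ.apply_apply hij hik, Equiv.swap_apply_left]

theorem semiconjBy_chainOp (hσ : IsExchange l N σ)
    (hLeib : ∀ i (a b : KK l N), pd i (a * b) = a * pd i b + pd i a * b)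
    (hX : ∀ i j, pd i (ww l N j) = if j = i then 1 else 0)
    (p : ℕ) (c : Fin (p + 1) → Fin N) (hc : StrictMono c) :
    SemiconjBy (chainOp l N σ p c) (symDop l N σ pd (c 0))
      (symDop l N σ pd (c (Fin.last p))) := by
  induction p with
  | zero =>
    have h1 : chainOp l N σ 0 c = 1 := by simp [chainOp]
    rw [h1]
    exact SemiconjBy.one_left _
  | succ p ih =>
    rw [chainOp_succ]
    exact (semiconjBy_symDop hσ hLeib hX (hc (Fin.castSucc_lt_last _)).ne).mul_left
      (ih (c ∘ Fin.castSucc) (hc.comp Fin.strictMono_castSucc))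

variable (l N σ pd)

theorem statement17 (hN : 1 ≤ N)
    (hσ : ∀ i k, i ≠ k →
      (σ i k) (ww l N i) = ww l N k ∧ (σ i k) (ww l N k) = ww l N i ∧
        ∀ j, j ≠ i → j ≠ k → (σ i k) (ww l N j) = ww l N j)
    (hLeib : ∀ i (a b : KK l N), pd i (a * b) = a * pd i b + pd i a * b)
    (hX : ∀ i j, pd i (ww l N j) = if j = i then 1 else 0)
    (p : ℕ) (c : Fin (p + 1) → Fin N) (hc : StrictMono c) :
    chainOp l N σ p c *
        (Dop l N σ pd (c 0) +
          mulOp l N (tt l N) * ∑ k ∈ Finset.Ioi (c 0), sL l N σ (c 0) k)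
      = (Dop l N σ pd (c (Fin.last p)) +
          mulOp l N (tt l N) * ∑ k ∈ Finset.Ioi (c (Fin.last p)), sL l N σ (c (Fin.last p)) k) *
          chainOp l N σ p c := by
  exact semiconjBy_chainOp hσ hLeib hX p c hc
end
end
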